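/- For the Adam iterates with 0 ≤ β1 < β2 < 1, for every s ≥ 1: max{ ‖x_{s+1} − x_s‖, ‖y_s − x_s‖, ‖y_{s+1} − y_s‖ } ≤ η·√( 4d / (β2(1−β1)²(1−β2)(1−β1/β2)) ). In particular, if η ≤ 1/(Lq·F) with F := √(4d/(β2(1−β1)²(1−β2)(1−β1/β2))) and Lq > 0, then all three distances are at most 1/Lq. -/

import Mathlib

theorem weighted_sq_add_le {β c m g W : ℝ} (hβ0 : 0 ≤ β) (hβ1 : β ≤ 1) (hc : 0 ≤ c) (hW : 0 ≤ W)
    (h : m ^ 2 ≤ c * W) :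
    (β * m + (1 - β) * g) ^ 2 ≤ (β * c + (1 - β)) * (β * W + (1 - β) * g ^ 2) := by
  have hcg : 0 ≤ c * g ^ 2 := by positivity
  have key : 2 * (m * g) ≤ c * g ^ 2 + W := by
    apply le_of_sq_le_sq _ (by positivity)
    nlinarith [sq_nonneg (c * g ^ 2 - W), mul_le_mul_of_nonneg_right h (sq_nonneg g)]
  nlinarith [mul_le_mul_of_nonneg_left key (mul_nonneg hβ0 (sub_nonneg.2 hβ1)),
    mul_le_mul_of_nonneg_left h (sq_nonneg β)]

/-- The square of the first-moment average is controlled by the second-moment average. -/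
theorem adam_moment_sq_le {β1 β2 : ℝ} (hβ1 : 0 ≤ β1) (hβ12 : β1 < β2) (hβ2 : β2 < 1)
    {g m v : ℕ → ℝ} (hm0 : m 0 = 0) (hv0 : v 0 = 0)
    (hm : ∀ s, m (s + 1) = β1 * m s + (1 - β1) * g (s + 1))
    (hv : ∀ s, v (s + 1) = β2 * v s + (1 - β2) * g (s + 1) ^ 2) (s : ℕ) :
    0 ≤ v s ∧ m s ^ 2 ≤ (1 - β1 ^ s) * ((1 - β1) / (1 - β2) * v s) := by
  induction s with
  | zero => simp [hm0, hv0]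
  | succ s ih =>
    obtain ⟨h0, h1⟩ := ih
    have h2 : 0 < 1 - β2 := by linarith
    have h3 : 0 < 1 - β1 := by linarith
    have hc : β1 ^ s ≤ 1 := pow_le_one₀ hβ1 (by linarith)
    have hc' : β1 ^ (s + 1) ≤ 1 := pow_le_one₀ hβ1 (by linarith)
    have hβ2' : 0 ≤ β2 := by linarith
    refine ⟨by rw [hv]; positivity, ?_⟩
    rw [hm, hv]
    refine (weighted_sq_add_le hβ1 (by linarith) (by linarith) (by positivity) h1).trans ?_
    have e : β1 * (1 - β1 ^ s) + (1 - β1) = 1 - β1 ^ (s + 1) := by ring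
    rw [e]
    refine mul_le_mul_of_nonneg_left ?_ (by linarith)
    have e2 : (1 - β1) / (1 - β2) * (β2 * v s + (1 - β2) * g (s + 1) ^ 2) =
        β2 * ((1 - β1) / (1 - β2) * v s) + (1 - β1) * g (s + 1) ^ 2 := by
      field_simp
    rw [e2]
    gcongr

/-- A coordinate of an Adam step is at most `η / √(1 - β2)` in absolute value. -/
theorem adam_step_sq_le {β1 β2 η ε m v : ℝ} {s : ℕ} (hs : 1 ≤ s) (hβ1 : 0 ≤ β1) (hβ12 : β1 < β2)
    (hβ2 : β2 < 1) (hε : 0 < ε) (hv : 0 ≤ v)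
    (hmv : m ^ 2 ≤ (1 - β1 ^ s) * ((1 - β1) / (1 - β2) * v)) :
    (η * √(1 - β2 ^ s) / (1 - β1 ^ s) * m / (√v + ε * √(1 - β2 ^ s))) ^ 2 ≤ η ^ 2 / (1 - β2) := by
  have h2 : 0 < 1 - β2 := by linarith
  have h3 : 0 < 1 - β1 := by linarith
  have hc : 1 - β1 ≤ 1 - β1 ^ s := by
    have := pow_le_of_le_one hβ1 (by linarith) (by omega : s ≠ 0)
    linarith
  have hp : 0 < 1 - β2 ^ s := by
    have := pow_lt_one₀ (by linarith) hβ2 (by omega : s ≠ 0)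
    linarith
  have hp1 : 1 - β2 ^ s ≤ 1 := by
    have : 0 ≤ β2 ^ s := pow_nonneg (by linarith) s
    linarith
  set c := 1 - β1 ^ s
  set p := 1 - β2 ^ s
  have hc0 : 0 < c := by linarith
  have hb : 0 < √v + ε * √p := by positivity
  have hvb : v ≤ (√v + ε * √p) ^ 2 := by
    calc v = √v ^ 2 := (Real.sq_sqrt hv).symm
      _ ≤ _ := by
        gcongr
        exact le_add_of_nonneg_right (by positivity)
  rw [div_pow, div_le_iff₀ (by positivity)]
  calc (η * √p / c * m) ^ 2 = η ^ 2 * p / c ^ 2 * m ^ 2 := by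
        rw [mul_pow, div_pow, mul_pow, Real.sq_sqrt hp.le]
    _ ≤ η ^ 2 * p / c ^ 2 * (c * ((1 - β1) / (1 - β2) * v)) := by gcongr
    _ = η ^ 2 / (1 - β2) * (p * ((1 - β1) / c) * v) := by field_simp
    _ ≤ η ^ 2 / (1 - β2) * (1 * 1 * v) := by
        gcongr
        exact (div_le_one hc0).2 hc
    _ ≤ η ^ 2 / (1 - β2) * (√v + ε * √p) ^ 2 := by
        rw [one_mul, one_mul]
        gcongr

theorem EuclideanSpace.norm_le_sqrt_card_mul {d : ℕ} {z : EuclideanSpace ℝ (Fin d)} {a : ℝ}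
    (h : ∀ i, z i ^ 2 ≤ a) : ‖z‖ ≤ √(d * a) := by
  rw [EuclideanSpace.norm_eq]
  apply Real.sqrt_le_sqrt
  simpa using Finset.sum_le_card_nsmul Finset.univ (fun i => z i ^ 2) a (by simpa using h)

theorem stmt_16
    (d T : ℕ) (hd : 1 ≤ d) (hT : 1 ≤ T)
    (β1 β2 η ε : ℝ)
    (hβ1 : 0 ≤ β1) (hβ12 : β1 < β2) (hβ2 : β2 < 1)
    (hη : 0 < η) (hε : 0 < ε)
    (g m v x y : ℕ → EuclideanSpace ℝ (Fin d))
    (hm0 : m 0 = 0) (hv0 : v 0 = 0)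
    (hm : ∀ s, 1 ≤ s → ∀ i, m s i = β1 * m (s - 1) i + (1 - β1) * g s i)
    (hv : ∀ s, 1 ≤ s → ∀ i, v s i = β2 * v (s - 1) i + (1 - β2) * (g s i) ^ 2)
    (ηs : ℕ → ℝ) (hηs : ∀ s, 1 ≤ s → ηs s = η * Real.sqrt (1 - β2 ^ s) / (1 - β1 ^ s))
    (b : ℕ → Fin d → ℝ)
    (hb : ∀ s i, b s i = Real.sqrt (v s i) + ε * Real.sqrt (1 - β2 ^ s))
    (hx : ∀ s, 1 ≤ s → ∀ i, x (s + 1) i = x s i - ηs s * m s i / b s i)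
    (hy1 : y 1 = x 1)
    (hy : ∀ s, 2 ≤ s → y s = x s + (β1 / (1 - β1)) • (x s - x (s - 1))) :
    (∀ s, 1 ≤ s →
      max (max ‖x (s + 1) - x s‖ ‖y s - x s‖) ‖y (s + 1) - y s‖ ≤
        η * Real.sqrt (4 * d / (β2 * (1 - β1) ^ 2 * (1 - β2) * (1 - β1 / β2)))) ∧
    (∀ Lq : ℝ, 0 < Lq →
      η ≤ 1 / (Lq * Real.sqrt (4 * d / (β2 * (1 - β1) ^ 2 * (1 - β2) * (1 - β1 / β2)))) →
      ∀ s, 1 ≤ s →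
        max (max ‖x (s + 1) - x s‖ ‖y s - x s‖) ‖y (s + 1) - y s‖ ≤ 1 / Lq) := by
  have h2 : 0 < 1 - β2 := by linarith
  have h3 : 0 < 1 - β1 := by linarith
  have h4 : 0 < β2 - β1 := by linarith
  have hβ20 : 0 < β2 := by linarith
  set A := √(d * (η ^ 2 / (1 - β2))) with hA
  have hA0 : 0 ≤ A := Real.sqrt_nonneg _
  have hstep : ∀ s, 1 ≤ s → ‖x (s + 1) - x s‖ ≤ A := fun s hs =>
    EuclideanSpace.norm_le_sqrt_card_mul fun i => by
      obtain ⟨hv', hmv⟩ := adam_moment_sq_le (g := fun s => g s i) (m := fun s => m s i)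
        (v := fun s => v s i) hβ1 hβ12 hβ2 (by simp [hm0]) (by simp [hv0])
        (fun s => hm (s + 1) (by omega) i) (fun s => hv (s + 1) (by omega) i) s
      have := adam_step_sq_le (η := η) hs hβ1 hβ12 hβ2 hε hv' hmv
      rw [PiLp.sub_apply, hx s hs i, hηs s hs, hb]
      simpa using this
  have hbound : 2 / (1 - β1) * A ≤
      η * √(4 * d / (β2 * (1 - β1) ^ 2 * (1 - β2) * (1 - β1 / β2))) := by
    have e1 : 2 / (1 - β1) * A = √((2 / (1 - β1)) ^ 2 * (d * (η ^ 2 / (1 - β2)))) := by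
      rw [Real.sqrt_mul (by positivity), Real.sqrt_sq (by positivity)]
    have e2 : β2 * (1 - β1) ^ 2 * (1 - β2) * (1 - β1 / β2) =
        (1 - β1) ^ 2 * (1 - β2) * (β2 - β1) := by
      field_simp
    rw [e1, e2]
    nth_rewrite 2 [← Real.sqrt_sq hη.le]
    rw [← Real.sqrt_mul (by positivity)]
    apply Real.sqrt_le_sqrt
    calc (2 / (1 - β1)) ^ 2 * (d * (η ^ 2 / (1 - β2)))
        = η ^ 2 * (4 * d / ((1 - β1) ^ 2 * (1 - β2) * 1)) := by field_simp; ring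
      _ ≤ _ := by
        gcongr
        linarith
  have hA2 : A ≤ 2 / (1 - β1) * A :=
    le_mul_of_one_le_left hA0 ((one_le_div h3).2 (by linarith))
  have hyx : ∀ s, 2 ≤ s → ‖y s - x s‖ ≤ 2 / (1 - β1) * A := fun s hs => by
    have h := hstep (s - 1) (by omega)
    rw [Nat.sub_add_cancel (by omega : 1 ≤ s)] at h
    rw [hy s hs, add_sub_cancel_left, norm_smul, Real.norm_of_nonneg (by positivity)]
    gcongr
    linarith
  have hyy : ∀ s, 1 ≤ s → ‖y (s + 1) - y s‖ ≤ 2 / (1 - β1) * A := fun s hs => by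
    have h := hstep s hs
    have hy' := hy (s + 1) (by omega)
    rw [Nat.add_sub_cancel] at hy'
    have e0 : 1 + β1 / (1 - β1) = 1 / (1 - β1) := by field_simp; ring
    rcases hs.eq_or_lt with rfl | hs'
    · have e : y (1 + 1) - y 1 = (1 / (1 - β1)) • (x (1 + 1) - x 1) := by
        rw [hy', hy1, ← e0]
        module
      rw [e, norm_smul, Real.norm_of_nonneg (by positivity)]
      gcongr
      norm_num
    · have h' := hstep (s - 1) (by omega)
      rw [Nat.sub_add_cancel hs] at h'
      have e : y (s + 1) - y s =
          (1 / (1 - β1)) • (x (s + 1) - x s) - (β1 / (1 - β1)) • (x s - x (s - 1)) := by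
        rw [hy', hy s hs', ← e0]
        module
      rw [e]
      refine (norm_sub_le _ _).trans ?_
      rw [norm_smul, norm_smul, Real.norm_of_nonneg (by positivity),
        Real.norm_of_nonneg (by positivity)]
      calc 1 / (1 - β1) * ‖x (s + 1) - x s‖ + β1 / (1 - β1) * ‖x s - x (s - 1)‖
          ≤ 1 / (1 - β1) * A + 1 / (1 - β1) * A := by
            gcongr
            linarith
        _ = 2 / (1 - β1) * A := by ring
  have main : ∀ s, 1 ≤ s → max (max ‖x (s + 1) - x s‖ ‖y s - x s‖) ‖y (s + 1) - y s‖ ≤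
      η * √(4 * d / (β2 * (1 - β1) ^ 2 * (1 - β2) * (1 - β1 / β2))) := fun s hs => by
    refine le_trans (max_le (max_le ((hstep s hs).trans hA2) ?_) (hyy s hs)) hbound
    rcases hs.eq_or_lt with rfl | hs'
    · rw [hy1, sub_self, norm_zero]
      positivity
    · exact hyx s hs'
  refine ⟨main, fun Lq hLq hle s hs => (main s hs).trans ?_⟩
  refine (mul_le_mul_of_nonneg_right hle (Real.sqrt_nonneg _)).trans ?_
  rw [← div_div, div_mul_eq_mul_div, mul_div_assoc]
  exact mul_le_of_le_one_right (by positivity) (div_self_le_one _)
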